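/- arXiv:math/0606367 — 2 statements merged into one kernel-verified Lean document; each statement's English description precedes it below -/
import Mathlib

section
/- Let Γ be a discrete group and let f ∈ ℓ¹(Γ). The following are equivalent: (1) the convolution operator ρ_f : ℓ∞(Γ) → ℓ∞(Γ) is injective; (2) ρ_f is bijective; (3) f is invertible in ℓ¹(Γ), i.e. there exists g ∈ ℓ¹(Γ) with f*g = δ_e = g*f. -/
/-- Convolution on `ℓ¹(Γ)`: `(f * g)(z) = ∑_{y} f(zy⁻¹) g(y)`. -/
noncomputable def conv {Γ : Type*} [Group Γ] (f g : Γ → ℂ) : Γ → ℂ :=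
  fun z => ∑' y : Γ, f (z * y⁻¹) * g y

/-- The convolution operator `ρ_f(g)(x) = ∑_{y} g(xy) f(y)`. -/
noncomputable def rho {Γ : Type*} [Group Γ] (f g : Γ → ℂ) : Γ → ℂ :=
  fun x => ∑' y : Γ, g (x * y) * f y

open Classical in
/-- The unit `δ_e` of `ℓ¹(Γ)`, the indicator function of the identity element. -/
noncomputable def deltaOne (Γ : Type*) [Group Γ] : Γ → ℂ :=
  fun z => if z = 1 then 1 else 0

/-- `g ∈ ℓ∞(Γ)`. -/
def IsBddFun {Γ : Type*} (g : Γ → ℂ) : Prop := ∃ C, ∀ x, ‖g x‖ ≤ C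

lemma Submodule.exists_dual_ne_zero_of_notMem_topologicalClosure {𝕜 E : Type*} [RCLike 𝕜]
    [NormedAddCommGroup E] [NormedSpace 𝕜 E] {M : Submodule 𝕜 E} {v : E}
    (hv : v ∉ M.topologicalClosure) : ∃ φ : StrongDual 𝕜 E, (∀ w ∈ M, φ w = 0) ∧ φ v ≠ 0 := by
  have : IsClosed (M.topologicalClosure : Set E) := M.isClosed_topologicalClosure
  obtain ⟨ψ, hψ⟩ := SeparatingDual.exists_ne_zero (R := 𝕜) (x := M.topologicalClosure.mkQ v)
    (by simpa using hv)
  refine ⟨ψ.comp M.topologicalClosure.mkQL, fun w hw => ?_, hψ⟩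
  have : M.topologicalClosure.mkQ w = 0 := by
    simpa using M.le_topologicalClosure hw
  exact (congrArg ψ this).trans (map_zero ψ)

/-- Orthogonal projection of `e` to the space of vectors orthogonal to all `v i`. -/
lemma exists_inner_eq_of_forall_inner_eq_zero {𝕜 E ι : Type*} [RCLike 𝕜]
    [NormedAddCommGroup E] [InnerProductSpace 𝕜 E] [CompleteSpace E] (v : ι → E) (e : E) :
    ∃ ξ : E, (∀ i, inner 𝕜 (v i) ξ = 0) ∧
      ∀ h : E, (∀ i, inner 𝕜 (v i) h = 0) → inner 𝕜 ξ h = inner 𝕜 e h := by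
  let K : Submodule 𝕜 E := (Submodule.span 𝕜 (Set.range v))ᗮ
  have hK (h : E) : h ∈ K ↔ ∀ i, inner 𝕜 (v i) h = 0 := by
    refine ⟨fun hh i => (Submodule.mem_orthogonal _ _).1 hh _ (Submodule.subset_span ⟨i, rfl⟩),
      fun hh => (Submodule.mem_orthogonal _ _).2 fun w hw => ?_⟩
    induction hw using Submodule.span_induction with
    | mem w hw => obtain ⟨i, rfl⟩ := hw; exact hh i
    | zero => simp
    | add a b _ _ ha hb => rw [inner_add_left, ha, hb, add_zero]
    | smul c a _ ha => rw [inner_smul_left, ha, mul_zero]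
  refine ⟨K.starProjection e, (hK _).1 (K.starProjection_apply_mem e), fun h hh => ?_⟩
  rw [K.inner_starProjection_left_eq_right, K.starProjection_eq_self_iff.2 ((hK h).2 hh)]

section Convolution

variable {Γ : Type*}

lemma isBddFun_of_summable {a : Γ → ℂ} (ha : Summable fun x => ‖a x‖) : IsBddFun a :=
  ⟨∑' x, ‖a x‖, fun x => ha.le_tsum x fun _ _ => norm_nonneg _⟩

lemma IsBddFun.mul_summable {u a : Γ → ℂ} (hu : IsBddFun u) (ha : Summable fun x => ‖a x‖) :
    Summable fun x => ‖u x * a x‖ := by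
  obtain ⟨C, hC⟩ := hu
  refine (ha.mul_left C).of_nonneg_of_le (fun _ => norm_nonneg _) fun x => ?_
  rw [norm_mul]
  gcongr
  exact hC x

lemma summable_mul_prod {a b : Γ → ℂ} (ha : Summable fun x => ‖a x‖)
    (hb : Summable fun x => ‖b x‖) : Summable fun p : Γ × Γ => ‖a p.1 * b p.2‖ := by
  simpa only [norm_mul] using
    ha.mul_of_nonneg hb (fun _ => norm_nonneg _) (fun _ => norm_nonneg _)

lemma memℓp_one_iff {a : Γ → ℂ} : Memℓp a 1 ↔ Summable fun x => ‖a x‖ := by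
  simpa using memℓp_gen_iff (p := 1) (f := a) (by simp)

lemma norm_lp_one (h : lp (fun _ : Γ => ℂ) 1) : ‖h‖ = ∑' x, ‖h x‖ := by
  simpa using lp.norm_eq_tsum_rpow (p := 1) (by simp) h

open Classical in
/-- A bounded functional on `ℓ¹(Γ)` is the pairing with a bounded function. -/
lemma exists_isBddFun_dual (φ : StrongDual ℂ (lp (fun _ : Γ => ℂ) 1)) :
    ∃ u : Γ → ℂ, IsBddFun u ∧ ∀ h, φ h = ∑' x, u x * h x := by
  refine ⟨fun x => φ (lp.single 1 x 1), ⟨‖φ‖, fun x => ?_⟩, fun h => ?_⟩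
  · simpa [lp.norm_single] using φ.le_opNorm (lp.single 1 x 1)
  · have := (lp.hasSum_single (by simp) h).mapL φ
    rw [← this.tsum_eq]
    refine tsum_congr fun x => ?_
    have : lp.single 1 x (h x) = h x • (lp.single 1 x 1 : lp (fun _ : Γ => ℂ) 1) := by
      rw [← lp.single_smul]; simp
    rw [this, map_smul, smul_eq_mul, mul_comm]

variable [Group Γ]

/-- The shear `(z, y) ↦ (zy⁻¹, y)` of `Γ × Γ`. -/
def shearEquiv (Γ : Type*) [Group Γ] : Γ × Γ ≃ Γ × Γ where
  toFun p := (p.1 * p.2⁻¹, p.2)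
  invFun p := (p.1 * p.2, p.2)
  left_inv p := by simp
  right_inv p := by simp

lemma summable_conv_prod {a b : Γ → ℂ} (ha : Summable fun x => ‖a x‖)
    (hb : Summable fun x => ‖b x‖) :
    Summable fun p : Γ × Γ => ‖a (p.1 * p.2⁻¹) * b p.2‖ :=
  (shearEquiv Γ).summable_iff.2 (summable_mul_prod ha hb)

lemma norm_conv_le {a b : Γ → ℂ} (ha : Summable fun x => ‖a x‖)
    (hb : Summable fun x => ‖b x‖) (z : Γ) :
    ‖conv a b z‖ ≤ ∑' y, ‖a (z * y⁻¹) * b y‖ :=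
  norm_tsum_le_tsum_norm ((summable_conv_prod ha hb).prod_factor z)

lemma summable_conv {a b : Γ → ℂ} (ha : Summable fun x => ‖a x‖)
    (hb : Summable fun x => ‖b x‖) : Summable fun z => ‖conv a b z‖ :=
  (summable_conv_prod ha hb).prod.of_nonneg_of_le (fun _ => norm_nonneg _) (norm_conv_le ha hb)

lemma tsum_norm_conv_le {a b : Γ → ℂ} (ha : Summable fun x => ‖a x‖)
    (hb : Summable fun x => ‖b x‖) :
    ∑' z, ‖conv a b z‖ ≤ (∑' x, ‖a x‖) * ∑' x, ‖b x‖ := by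
  calc ∑' z, ‖conv a b z‖ ≤ ∑' z, ∑' y, ‖a (z * y⁻¹) * b y‖ :=
        (summable_conv ha hb).tsum_le_tsum (norm_conv_le ha hb) (summable_conv_prod ha hb).prod
    _ = ∑' p : Γ × Γ, ‖a (p.1 * p.2⁻¹) * b p.2‖ := (summable_conv_prod ha hb).tsum_prod.symm
    _ = ∑' p : Γ × Γ, ‖a p.1 * b p.2‖ :=
        (shearEquiv Γ).tsum_eq fun p : Γ × Γ => ‖a p.1 * b p.2‖
    _ = _ := by
        simp only [norm_mul]
        exact (ha.tsum_mul_tsum hb (by simpa only [norm_mul] using summable_mul_prod ha hb)).symm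

lemma rho_conv {a b u : Γ → ℂ} (ha : Summable fun x => ‖a x‖)
    (hb : Summable fun x => ‖b x‖) (hu : IsBddFun u) :
    rho (conv a b) u = rho a (rho b u) := by
  funext x
  obtain ⟨C, hC⟩ := hu
  let F : Γ × Γ → ℂ := fun p => u (x * p.1 * p.2) * (a p.1 * b p.2)
  have hF : Summable F := by
    refine .of_norm (((summable_mul_prod ha hb).mul_left C).of_nonneg_of_le
      (fun _ => norm_nonneg _) fun p => ?_)
    rw [norm_mul]
    gcongr
    exact hC _
  calc rho (conv a b) u x = ∑' z, ∑' y, F (shearEquiv Γ (z, y)) := by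
        simp only [rho, conv, ← tsum_mul_left]
        simp [F, shearEquiv, mul_assoc]
    _ = ∑' p, F p := by
        rw [← (shearEquiv Γ).tsum_eq F]
        exact ((shearEquiv Γ).summable_iff.2 hF).tsum_prod.symm
    _ = rho a (rho b u) x := by
        rw [hF.tsum_prod]
        simp only [rho, ← tsum_mul_right]
        simp [F, mul_assoc, mul_comm (b _)]

lemma summable_comp_inv {a : Γ → ℂ} (ha : Summable fun x => ‖a x‖) :
    Summable fun x => ‖a x⁻¹‖ :=
  (Equiv.inv Γ).summable_iff.2 ha

lemma summable_comp_mul_left {a : Γ → ℂ} (ha : Summable fun x => ‖a x‖) (y : Γ) :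
    Summable fun x => ‖a (y * x)‖ :=
  (Equiv.mulLeft y).summable_iff.2 ha

lemma conv_eq_rho (a b : Γ → ℂ) : conv a b = rho (fun y => b y⁻¹) a := by
  funext z
  exact ((Equiv.inv Γ).tsum_eq fun y => a (z * y⁻¹) * b y).symm.trans (by simp [rho])

lemma conv_comp_inv (a b : Γ → ℂ) :
    (fun z => conv a b z⁻¹) = conv (fun y => b y⁻¹) (fun y => a y⁻¹) := by
  funext z
  rw [conv, ← (Equiv.mulRight z⁻¹).tsum_eq, conv]
  refine tsum_congr fun y => ?_
  simp [mul_comm]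

lemma conv_assoc {a b c : Γ → ℂ} (ha : Summable fun x => ‖a x‖)
    (hb : Summable fun x => ‖b x‖) (hc : Summable fun x => ‖c x‖) :
    conv (conv a b) c = conv a (conv b c) := by
  rw [conv_eq_rho a (conv b c), conv_comp_inv,
    rho_conv (summable_comp_inv hc) (summable_comp_inv hb) (isBddFun_of_summable ha),
    ← conv_eq_rho, ← conv_eq_rho]

lemma summable_deltaOne : Summable fun x : Γ => ‖deltaOne Γ x‖ :=
  summable_of_hasFiniteSupport ((Set.finite_singleton 1).subset fun x => by
    simp [deltaOne])

lemma rho_deltaOne (u : Γ → ℂ) : rho (deltaOne Γ) u = u := by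
  funext x
  rw [rho, tsum_eq_single 1 fun y hy => by simp [deltaOne, hy]]
  simp [deltaOne]

lemma conv_deltaOne (u : Γ → ℂ) : conv u (deltaOne Γ) = u := by
  rw [conv_eq_rho]
  convert rho_deltaOne u using 2
  funext x
  by_cases h : x = 1 <;> simp [deltaOne, h]

lemma deltaOne_conv (u : Γ → ℂ) : conv (deltaOne Γ) u = u := by
  funext z
  rw [conv, tsum_eq_single z fun y hy => by
    simp [deltaOne, mul_inv_eq_one, hy.symm]]
  simp [deltaOne]

lemma isBddFun_rho {a u : Γ → ℂ} (ha : Summable fun x => ‖a x‖) (hu : IsBddFun u) :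
    IsBddFun (rho a u) := by
  obtain ⟨C, hC⟩ := hu
  refine ⟨∑' y, C * ‖a y‖, fun x => tsum_of_norm_bounded (ha.mul_left C).hasSum fun y => ?_⟩
  rw [norm_mul]
  gcongr
  exact hC _

lemma conv_sub {a b c : Γ → ℂ} (ha : Summable fun x => ‖a x‖)
    (hb : Summable fun x => ‖b x‖) (hc : Summable fun x => ‖c x‖) :
    conv a (b - c) = conv a b - conv a c := by
  funext z
  simp only [conv, Pi.sub_apply, mul_sub]
  exact ((summable_conv_prod ha hb).prod_factor z).of_norm.tsum_sub
    ((summable_conv_prod ha hc).prod_factor z).of_norm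

lemma deltaOne_translate_conv (x : Γ) (u : Γ → ℂ) :
    conv (fun z => deltaOne Γ (x⁻¹ * z)) u = fun z => u (x⁻¹ * z) := by
  funext z
  rw [conv]
  simpa only [mul_assoc, conv] using congrFun (deltaOne_conv u) (x⁻¹ * z)

lemma rho_comp_mul_left (a u : Γ → ℂ) (x : Γ) :
    rho a (fun y => u (x * y)) = fun y => rho a u (x * y) := by
  funext y
  simp [rho, mul_assoc]

/-- Right convolution `h ↦ h * r` as a bounded operator on `ℓ¹(Γ)`. -/
noncomputable def convRight (r : lp (fun _ : Γ => ℂ) 1) :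
    lp (fun _ : Γ => ℂ) 1 →L[ℂ] lp (fun _ : Γ => ℂ) 1 :=
  LinearMap.mkContinuous
    { toFun h := ⟨conv h r, memℓp_one_iff.2 <|
        summable_conv (memℓp_one_iff.1 h.2) (memℓp_one_iff.1 r.2)⟩
      map_add' h k := by
        ext z
        have hs (h : lp (fun _ : Γ => ℂ) 1) : Summable fun y => h (z * y⁻¹) * r y :=
          ((summable_conv_prod (memℓp_one_iff.1 h.2)
            (memℓp_one_iff.1 r.2)).prod_factor z).of_norm
        refine (tsum_congr fun y => ?_).trans ((hs h).tsum_add (hs k))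
        simp [add_mul]
      map_smul' c h := by
        ext z
        simp [conv, mul_assoc, tsum_mul_left] }
    ‖r‖ fun h => by
      rw [norm_lp_one, norm_lp_one, norm_lp_one, mul_comm]
      exact tsum_norm_conv_le (memℓp_one_iff.1 h.2) (memℓp_one_iff.1 r.2)

lemma coe_convRight (r h : lp (fun _ : Γ => ℂ) 1) : ⇑(convRight r h) = conv h r := rfl

lemma norm_convRight_le (r : lp (fun _ : Γ => ℂ) 1) : ‖convRight r‖ ≤ ‖r‖ :=
  LinearMap.mkContinuous_norm_le _ (norm_nonneg _) _

/-- An element of `ℓ¹(Γ)` at distance less than `1` from `δ_e` has a left inverse. -/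
lemma exists_conv_eq_deltaOne_of_norm_sub_lt_one (d a : lp (fun _ : Γ => ℂ) 1)
    (hd : ⇑d = deltaOne Γ) (h : ‖d - a‖ < 1) :
    ∃ k : lp (fun _ : Γ => ℂ) 1, conv k a = deltaOne Γ := by
  have hr : ‖convRight (d - a)‖ < 1 := (norm_convRight_le _).trans_lt h
  let v := Units.oneSub _ hr
  let k := (↑v⁻¹ : lp (fun _ : Γ => ℂ) 1 →L[ℂ] lp (fun _ : Γ => ℂ) 1) d
  have hk : (1 - convRight (d - a)) k = d := DFunLike.congr_fun v.mul_inv d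
  have cancel {κ α : Γ → ℂ} (hκ : Summable fun x => ‖κ x‖) (hα : Summable fun x => ‖α x‖)
      (h : κ - conv κ (deltaOne Γ - α) = deltaOne Γ) : conv κ α = deltaOne Γ := by
    rwa [conv_sub hκ summable_deltaOne hα, conv_deltaOne, sub_sub_cancel] at h
  refine ⟨k, cancel (memℓp_one_iff.1 k.2) (memℓp_one_iff.1 a.2) ?_⟩
  rw [← hd]
  exact congrArg (fun h : lp (fun _ : Γ => ℂ) 1 => (h : Γ → ℂ)) hk

/-- If `ρ_f` is injective on bounded functions then right convolution by `f` has dense range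
in `ℓ¹(Γ)`. -/
lemma range_convRight_dense (f : lp (fun _ : Γ => ℂ) 1)
    (hinj : ∀ u, IsBddFun u → rho f u = 0 → u = 0) :
    (convRight f).range.topologicalClosure = ⊤ := by
  refine Submodule.eq_top_iff'.2 fun v => ?_
  by_contra hv
  obtain ⟨φ, hM, hv0⟩ := Submodule.exists_dual_ne_zero_of_notMem_topologicalClosure hv
  obtain ⟨u, hu, hφ⟩ := exists_isBddFun_dual φ
  have hu0 : u = 0 := by
    refine hinj u hu (funext fun x => ?_)
    let e : lp (fun _ : Γ => ℂ) 1 :=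
      ⟨fun z => deltaOne Γ (x⁻¹ * z),
        memℓp_one_iff.2 (summable_comp_mul_left summable_deltaOne x⁻¹)⟩
    have h0 := hM (convRight f e) ⟨e, rfl⟩
    rw [hφ, coe_convRight, deltaOne_translate_conv, ← (Equiv.mulLeft x).tsum_eq] at h0
    simpa [rho] using h0
  exact hv0 (by rw [hφ v, hu0]; simp)

lemma exists_left_inverse {f : Γ → ℂ} (hf : Summable fun x => ‖f x‖)
    (hinj : ∀ u, IsBddFun u → rho f u = 0 → u = 0) :
    ∃ g : Γ → ℂ, (Summable fun x => ‖g x‖) ∧ conv g f = deltaOne Γ := by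
  let F : lp (fun _ : Γ => ℂ) 1 := ⟨f, memℓp_one_iff.2 hf⟩
  let d : lp (fun _ : Γ => ℂ) 1 := ⟨deltaOne Γ, memℓp_one_iff.2 summable_deltaOne⟩
  have hd : d ∈ ((convRight F).range).topologicalClosure := by
    rw [range_convRight_dense F hinj]; trivial
  obtain ⟨_, ⟨h, rfl⟩, hh⟩ := Metric.mem_closure_iff.1 hd 1 one_pos
  rw [dist_eq_norm] at hh
  obtain ⟨k, hk⟩ := exists_conv_eq_deltaOne_of_norm_sub_lt_one d _ rfl hh
  have hk1 := memℓp_one_iff.1 k.2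
  have hh1 := memℓp_one_iff.1 h.2
  exact ⟨conv k h, summable_conv hk1 hh1, (conv_assoc hk1 hh1 hf).trans hk⟩

/-- The functional `h ↦ h(e)` on the kernel of `ρ_g` in `ℓ²(Γ)` is represented by a vector of this
kernel. -/
lemma exists_kernel_vector {g : Γ → ℂ} (hg : Summable fun x => ‖g x‖) :
    ∃ ξ : Γ → ℂ, Memℓp ξ 2 ∧ rho g ξ = 0 ∧
      ∀ h : Γ → ℂ, Memℓp h 2 → rho g h = 0 → h 1 = ∑' y, h y * star (ξ y) := by
  classical
  have hv (x : Γ) : Memℓp (fun z => star (g (x⁻¹ * z))) 2 := by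
    refine Memℓp.of_exponent_ge (q := 1) (memℓp_one_iff.2 ?_) one_le_two
    simp only [norm_star]
    exact summable_comp_mul_left hg x⁻¹
  let v (x : Γ) : lp (fun _ : Γ => ℂ) 2 := ⟨_, hv x⟩
  have inner_v (x : Γ) (h : lp (fun _ : Γ => ℂ) 2) : inner ℂ (v x) h = rho g h x := by
    rw [lp.inner_eq_tsum, ← (Equiv.mulLeft x).tsum_eq]
    simp [v, rho]
  obtain ⟨ξ, hξ, hrep⟩ := exists_inner_eq_of_forall_inner_eq_zero (𝕜 := ℂ) v (lp.single 2 1 1)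
  refine ⟨ξ, ξ.2, funext fun x => (inner_v x ξ).symm.trans (hξ x), fun h hh h0 => ?_⟩
  have h1 := hrep ⟨h, hh⟩ fun x => (inner_v x ⟨h, hh⟩).trans (congrFun h0 x)
  rw [lp.inner_single_left, lp.inner_eq_tsum] at h1
  simpa using h1.symm

/-- The algebra `ℓ¹(Γ)` is directly finite. -/
theorem conv_eq_deltaOne_comm {f g : Γ → ℂ} (hf : Summable fun x => ‖f x‖)
    (hg : Summable fun x => ‖g x‖) (h : conv g f = deltaOne Γ) : conv f g = deltaOne Γ := by
  obtain ⟨ξ, hξ2, hξ, hrep⟩ := exists_kernel_vector hg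
  have hfg := summable_conv hf hg
  have mem_translate {u : Γ → ℂ} (hu : Memℓp u 2) (x : Γ) : Memℓp (fun y => u (x * y)) 2 := by
    rw [memℓp_gen_iff (by simp)] at hu ⊢
    exact (Equiv.mulLeft x).summable_iff.2 hu
  have hrep' (u : Γ → ℂ) (hu : Memℓp u 2) (hu0 : rho g u = 0) (x : Γ) :
      u x = ∑' y, u (x * y) * star (ξ y) := by
    simpa using hrep _ (mem_translate hu x) (by rw [rho_comp_mul_left, hu0]; rfl)
  have hsymm (x : Γ) : star (ξ x⁻¹) = ξ x := by
    rw [hrep' ξ hξ2 hξ x, hrep' ξ hξ2 hξ x⁻¹, ← (Equiv.mulLeft x).tsum_eq, tsum_star]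
    simp [mul_comm]
  let p : Γ → ℂ := deltaOne Γ - conv f g
  have hp : Summable fun x => ‖p x‖ :=
    (summable_deltaOne.add hfg).of_nonneg_of_le (fun _ => norm_nonneg _) fun x => norm_sub_le _ _
  have hgp : conv g p = 0 := by
    rw [conv_sub hg summable_deltaOne hfg, conv_deltaOne, ← conv_assoc hg hf hg, h,
      deltaOne_conv, sub_self]
  have hp2 : Memℓp (fun x => p x⁻¹) 2 :=
    Memℓp.of_exponent_ge (q := 1) (memℓp_one_iff.2 (summable_comp_inv hp)) one_le_two
  have hp0 : rho g (fun x => p x⁻¹) = 0 := by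
    have := conv_comp_inv g p
    rw [hgp, conv_eq_rho] at this
    simp only [inv_inv] at this
    exact this.symm
  have hp1 : p 1 = 0 := by
    have h1 : conv f g 1 = conv g f 1 := by
      rw [conv, conv, ← (Equiv.inv Γ).tsum_eq]
      simp [mul_comm]
    simp [p, h1, h]
  have hξb : IsBddFun ξ := by
    obtain ⟨C, hC⟩ := memℓp_infty_iff.1 (hξ2.of_exponent_ge le_top)
    exact ⟨C, fun x => hC ⟨x, rfl⟩⟩
  have hpξ : rho p ξ = ξ := by
    have h1 : rho (conv f g) ξ = 0 := by
      rw [rho_conv hf hg hξb, hξ]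
      funext x
      simp [rho]
    funext x
    have h2 : rho p ξ x = rho (deltaOne Γ) ξ x - rho (conv f g) ξ x := by
      have hb : IsBddFun fun y => ξ (x * y) := hξb.imp fun C hC y => hC _
      simp only [rho, p, Pi.sub_apply, mul_sub]
      exact (hb.mul_summable summable_deltaOne).of_norm.tsum_sub (hb.mul_summable hfg).of_norm
    rw [h2, h1, rho_deltaOne]
    simp
  have hξ1 : ξ 1 = 0 := by
    rw [← hpξ]
    have := hrep _ hp2 hp0
    rw [← (Equiv.inv Γ).tsum_eq] at this
    simp only [Equiv.inv_apply, inv_inv, inv_one, hp1, hsymm] at this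
    simpa [rho, mul_comm] using this.symm
  have hξ0 : ξ = 0 := by
    have hs : Summable fun y => ‖ξ y‖ ^ 2 := by
      simpa using (memℓp_gen_iff (p := 2) (by simp)).1 hξ2
    have h1 : ∑' y, ‖ξ y‖ ^ 2 = 0 := by
      have := hrep ξ hξ2 hξ
      rw [hξ1] at this
      simp only [Complex.star_def, Complex.mul_conj'] at this
      exact_mod_cast this.symm
    funext y
    have := (hasSum_zero_iff_of_nonneg (fun y => by positivity)).1 (h1 ▸ hs.hasSum)
    simpa using congrFun this y
  have : p = 0 := by
    funext x
    simpa [hξ0] using hrep' _ hp2 hp0 x⁻¹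
  exact (sub_eq_zero.1 this).symm

end Convolution

/-- For `f ∈ ℓ¹(Γ)` the following are equivalent: `ρ_f : ℓ∞(Γ) → ℓ∞(Γ)` is injective;
`ρ_f` is bijective; `f` is invertible in `ℓ¹(Γ)`. -/
theorem stmt1 {Γ : Type*} [Group Γ] (f : Γ → ℂ) (hf : Summable fun x => ‖f x‖) :
    List.TFAE
      [∀ g₁ g₂ : Γ → ℂ, IsBddFun g₁ → IsBddFun g₂ → rho f g₁ = rho f g₂ → g₁ = g₂,
       (∀ g₁ g₂ : Γ → ℂ, IsBddFun g₁ → IsBddFun g₂ → rho f g₁ = rho f g₂ → g₁ = g₂) ∧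
         (∀ h : Γ → ℂ, IsBddFun h → ∃ g : Γ → ℂ, IsBddFun g ∧ rho f g = h),
       ∃ g : Γ → ℂ, (Summable fun x => ‖g x‖) ∧
         conv f g = deltaOne Γ ∧ conv g f = deltaOne Γ] := by
  tfae_have 2 → 1 := And.left
  tfae_have 1 → 3 := fun hinj => by
    obtain ⟨g, hg, hgf⟩ := exists_left_inverse hf fun u hu h0 =>
      hinj u 0 hu ⟨0, by simp⟩ (h0.trans (by funext x; simp [rho]))
    exact ⟨g, hg, conv_eq_deltaOne_comm hf hg hgf, hgf⟩
  tfae_have 3 → 2 := by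
    rintro ⟨g, hg, hfg, hgf⟩
    refine ⟨fun u₁ u₂ h₁ h₂ h => ?_, fun h hh => ⟨rho g h, isBddFun_rho hg hh, ?_⟩⟩
    · rw [← rho_deltaOne u₁, ← rho_deltaOne u₂, ← hgf, rho_conv hg hf h₁, rho_conv hg hf h₂, h]
    · rw [← rho_conv hf hg hh, hfg, rho_deltaOne]
  tfae_finish
end

section
/- Let Γ be a discrete amenable group and let ω be any weight on Γ. Then the weighted convolution algebra ℓ¹(Γ,ω) is directly finite: if f, g : Γ → ℂ satisfy Σ_x |f(x)|ω(x) < ∞, Σ_x |g(x)|ω(x) < ∞, and g*f = δ_e, then f*g = δ_e. -/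
/-- `Γ` is amenable: it admits a left-invariant, finitely additive probability
measure defined on all subsets of `Γ`. -/
def IsAmenable (Γ : Type*) [Group Γ] : Prop :=
  ∃ μ : Set Γ → ℝ, (∀ S : Set Γ, 0 ≤ μ S) ∧ μ Set.univ = 1 ∧
    (∀ S T : Set Γ, Disjoint S T → μ (S ∪ T) = μ S + μ T) ∧
    ∀ (g : Γ) (S : Set Γ), μ ((fun x => g * x) '' S) = μ S

open scoped InnerProductSpace

namespace FinitelyAdditive

/-- The integral of a simple function against a finitely additive set function. -/
noncomputable def integral {α : Type*} [MeasurableSpace α] (μ : Set α → ℝ)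
    (F : MeasureTheory.SimpleFunc α ℝ) : ℝ :=
  F.setToSimpleFunc fun S => μ S • ContinuousLinearMap.id ℝ ℝ

variable {α : Type*} [MeasurableSpace α] {μ : Set α → ℝ}

lemma finMeasAdditive (hadd : ∀ S T : Set α, Disjoint S T → μ (S ∪ T) = μ S + μ T) :
    MeasureTheory.FinMeasAdditive (0 : MeasureTheory.Measure α)
      fun S => μ S • ContinuousLinearMap.id ℝ ℝ := by
  intro S T _ _ _ _ hST
  simp only [hadd S T hST, add_smul]

lemma integral_add (hadd : ∀ S T : Set α, Disjoint S T → μ (S ∪ T) = μ S + μ T)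
    (F G : MeasureTheory.SimpleFunc α ℝ) :
    integral μ (F + G) = integral μ F + integral μ G :=
  MeasureTheory.SimpleFunc.setToSimpleFunc_add _ (finMeasAdditive hadd)
    (MeasureTheory.integrable_zero_measure) (MeasureTheory.integrable_zero_measure)

lemma integral_le [Nonempty α] (hadd : ∀ S T : Set α, Disjoint S T → μ (S ∪ T) = μ S + μ T)
    (hnonneg : ∀ S, 0 ≤ μ S) (huniv : μ Set.univ = 1)
    {F : MeasureTheory.SimpleFunc α ℝ} {c : ℝ} (h : ∀ a, F a ≤ c) : integral μ F ≤ c := by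
  have h1 : integral μ F ≤ integral μ (MeasureTheory.SimpleFunc.const α c) :=
    MeasureTheory.SimpleFunc.setToSimpleFunc_mono (finMeasAdditive hadd)
      (fun S _ _ x hx => by simpa using mul_nonneg (hnonneg S) hx)
      MeasureTheory.integrable_zero_measure MeasureTheory.integrable_zero_measure h
  refine h1.trans_eq ?_
  have h0 : μ ∅ = 0 := by simpa using hadd ∅ ∅ (by simp)
  rw [integral, MeasureTheory.SimpleFunc.setToSimpleFunc_const _ (by simp [h0])]
  simp [huniv]

lemma integral_eq_of_image_eq {F G : MeasureTheory.SimpleFunc α ℝ} (σ : Equiv.Perm α)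
    (hσ : ∀ S, μ (σ '' S) = μ S) (h : ∀ a, G a = F (σ a)) :
    integral μ G = integral μ F := by
  have hr : G.range = F.range := by
    ext y
    simp only [MeasureTheory.SimpleFunc.mem_range, Set.mem_range, h]
    exact σ.surjective.exists (p := fun a => F a = y) |>.symm
  unfold integral MeasureTheory.SimpleFunc.setToSimpleFunc
  rw [hr]
  refine Finset.sum_congr rfl fun y _ => ?_
  have : F ⁻¹' {y} = σ '' (G ⁻¹' {y}) := by
    ext a
    simp [Equiv.image_eq_preimage_symm, h]
  simp [this, hσ]

end FinitelyAdditive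

/-- A weight on an amenable group dominates a positive character up to a constant factor. -/
theorem IsAmenable.exists_additive_le_log {Γ : Type*} [Group Γ] (hΓ : IsAmenable Γ) {ω : Γ → ℝ}
    (hωpos : ∀ x, 0 < ω x) (hωsub : ∀ x y, ω (x * y) ≤ ω x * ω y) :
    ∃ φ : Γ → ℝ, (∀ x y, φ (x * y) = φ x + φ y) ∧ ∀ x, φ x ≤ Real.log (ω x) + 1 := by
  obtain ⟨μ, hnonneg, huniv, hadd, hinv⟩ := hΓ
  let _ : MeasurableSpace Γ := ⊤
  have hlog : ∀ x y, Real.log (ω (x * y)) ≤ Real.log (ω x) + Real.log (ω y) := fun x y => by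
    rw [← Real.log_mul (hωpos x).ne' (hωpos y).ne']
    exact Real.log_le_log (hωpos _) (hωsub x y)
  set ψ : Γ → ℤ := fun y => ⌊Real.log (ω y)⌋ with hψ
  have hub : ∀ x y, ((ψ (x * y) - ψ y : ℤ) : ℝ) ≤ Real.log (ω x) + 1 := fun x y => by
    have h1 := Int.floor_le (Real.log (ω (x * y)))
    have h2 := Int.lt_floor_add_one (Real.log (ω y))
    have h3 := hlog x y
    push_cast
    linarith
  have hfin : ∀ x, (Set.range fun y => ((ψ (x * y) - ψ y : ℤ) : ℝ)).Finite := fun x => by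
    have : (Set.range fun y => ψ (x * y) - ψ y).Finite := by
      refine (Set.finite_Icc (-⌊Real.log (ω x⁻¹) + 1⌋) ⌊Real.log (ω x) + 1⌋).subset ?_
      rintro _ ⟨y, rfl⟩
      refine ⟨?_, Int.le_floor.2 (hub x y)⟩
      have := Int.le_floor.2 (hub x⁻¹ (x * y))
      rw [inv_mul_cancel_left] at this
      linarith
    refine (this.image ((↑) : ℤ → ℝ)).subset ?_
    rintro _ ⟨y, rfl⟩
    exact ⟨_, ⟨y, rfl⟩, rfl⟩
  let F : Γ → MeasureTheory.SimpleFunc Γ ℝ := fun x => ⟨_, fun _ => trivial, hfin x⟩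
  have hF : ∀ x y, F x y = ((ψ (x * y) - ψ y : ℤ) : ℝ) := fun _ _ => rfl
  refine ⟨fun x => FinitelyAdditive.integral μ (F x), fun x z => ?_, fun x =>
    FinitelyAdditive.integral_le hadd hnonneg huniv (hub x)⟩
  let G : MeasureTheory.SimpleFunc Γ ℝ :=
    (F x).comp (fun y => z * y) measurable_from_top
  have hG : ∀ y, G y = F x (z * y) := fun _ => rfl
  have hsum : F (x * z) = G + F z := by
    ext y
    rw [MeasureTheory.SimpleFunc.coe_add, Pi.add_apply, hG, hF, hF, hF, mul_assoc]
    push_cast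
    ring
  change FinitelyAdditive.integral μ (F (x * z)) = _
  rw [hsum, FinitelyAdditive.integral_add hadd,
    FinitelyAdditive.integral_eq_of_image_eq (Equiv.mulLeft z) (hinv z) hG]

section Representation

variable {Γ A : Type*} [NormedRing A] [NormedAlgebra ℂ A]

lemma summable_norm_smul {u : Γ → A} (hu : ∀ x, ‖u x‖ ≤ 1) {f : Γ → ℂ}
    (hf : Summable fun x => ‖f x‖) : Summable fun x => ‖f x • u x‖ :=
  hf.of_nonneg_of_le (fun _ => norm_nonneg _) fun x => by
    rw [norm_smul]
    exact mul_le_of_le_one_right (norm_nonneg _) (hu x)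

/-- A contractive representation turns convolution into multiplication. -/
lemma hasSum_conv_smul [Group Γ] [CompleteSpace A] (u : Γ →* A) (hu : ∀ x, ‖u x‖ ≤ 1)
    {f g : Γ → ℂ} (hf : Summable fun x => ‖f x‖) (hg : Summable fun x => ‖g x‖) :
    HasSum (fun z => conv f g z • u z) ((∑' x, f x • u x) * ∑' x, g x • u x) := by
  obtain ⟨σ, hσ⟩ : ∃ σ : Γ × Γ ≃ Γ × Γ, ∀ p, σ p = (p.1 * p.2⁻¹, p.2) :=
    ⟨{  toFun := fun p => (p.1 * p.2⁻¹, p.2)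
        invFun := fun p => (p.1 * p.2, p.2)
        left_inv := fun p => by simp
        right_inv := fun p => by simp }, fun _ => rfl⟩
  have hF := summable_norm_smul hu hf
  have hG := summable_norm_smul hu hg
  have hprod : HasSum (fun p : Γ × Γ => (f p.1 • u p.1) * (g p.2 • u p.2))
      ((∑' x, f x • u x) * ∑' x, g x • u x) := by
    rw [tsum_mul_tsum_of_summable_norm hF hG]
    exact (summable_mul_of_summable_norm hF hG).hasSum
  have hscalar : Summable fun p : Γ × Γ => f (p.1 * p.2⁻¹) * g p.2 := by
    have := σ.summable_iff.2 (summable_mul_of_summable_norm hf hg)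
    simpa only [Function.comp_def, hσ] using this
  have hprod' := σ.hasSum_iff.2 hprod
  simp only [Function.comp_def, hσ, smul_mul_smul_comm, ← map_mul, inv_mul_cancel_right] at hprod'
  exact hprod'.prod_fiberwise fun z => (hscalar.prod_factor z).hasSum.smul_const (u z)

end Representation

namespace HilbertBasis

variable {ι E : Type*} [NormedAddCommGroup E] [InnerProductSpace ℂ E]

lemma clm_ext (b : HilbertBasis ι ℂ E) {S T : E →L[ℂ] E} (h : ∀ i, S (b i) = T (b i)) : S = T :=
  ContinuousLinearMap.ext_on (s := Set.range b)
    (by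
      rw [dense_iff_closure_eq, ← Submodule.topologicalClosure_coe, b.dense_span]
      rfl)
    (by rintro _ ⟨i, rfl⟩; exact h i)

variable [CompleteSpace E]

/-- The unitary operator permuting the vectors of a Hilbert basis. -/
noncomputable def permute (b : HilbertBasis ι ℂ E) (σ : Equiv.Perm ι) : E ≃ₗᵢ[ℂ] E :=
  b.repr.trans (HilbertBasis.mk (b.orthonormal.comp σ σ.injective) (by
    rw [EquivLike.range_comp, b.dense_span])).repr.symm

@[simp]
lemma permute_apply_self (b : HilbertBasis ι ℂ E) (σ : Equiv.Perm ι) (i : ι) :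
    b.permute σ (b i) = b (σ i) := by
  classical
  rw [permute, LinearIsometryEquiv.trans_apply, b.repr_self, HilbertBasis.repr_symm_single,
    HilbertBasis.coe_mk, Function.comp_apply]

/-- The bounded operator underlying `HilbertBasis.permute`. -/
noncomputable def permuteL (b : HilbertBasis ι ℂ E) (σ : Equiv.Perm ι) : E →L[ℂ] E :=
  (b.permute σ).toContinuousLinearEquiv

@[simp]
lemma permuteL_apply_self (b : HilbertBasis ι ℂ E) (σ : Equiv.Perm ι) (i : ι) :
    b.permuteL σ (b i) = b (σ i) :=
  b.permute_apply_self σ i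

lemma permuteL_mul (b : HilbertBasis ι ℂ E) (σ τ : Equiv.Perm ι) :
    b.permuteL σ * b.permuteL τ = b.permuteL (σ * τ) :=
  b.clm_ext fun i => by simp

lemma permuteL_one (b : HilbertBasis ι ℂ E) : b.permuteL 1 = 1 :=
  b.clm_ext fun i => by simp

lemma norm_permuteL_le (b : HilbertBasis ι ℂ E) (σ : Equiv.Perm ι) : ‖b.permuteL σ‖ ≤ 1 :=
  ContinuousLinearMap.opNorm_le_bound _ zero_le_one fun x => by
    rw [one_mul]
    exact ((b.permute σ).norm_map x).le

lemma inner_permuteL_left (b : HilbertBasis ι ℂ E) (σ : Equiv.Perm ι) (x y : E) :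
    ⟪b.permuteL σ x, y⟫_ℂ = ⟪x, b.permuteL σ⁻¹ y⟫_ℂ := by
  have h : b.permuteL σ (b.permuteL σ⁻¹ y) = y := by
    rw [← mul_apply_eq_comp, permuteL_mul, mul_inv_cancel, permuteL_one,
      one_apply_eq_self]
  conv_lhs => rw [← h]
  exact (b.permute σ).inner_map_map _ _

section Group

variable {Γ : Type*} [Group Γ]

lemma inner_apply_of_commute (b : HilbertBasis Γ ℂ E) {S : E →L[ℂ] E}
    (hS : ∀ x, Commute S (b.permuteL (Equiv.mulRight x))) (x : Γ) :
    ⟪b 1, S (b x)⟫_ℂ = ⟪b x⁻¹, S (b 1)⟫_ℂ := by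
  have h : S (b x) = b.permuteL (Equiv.mulRight x) (S (b 1)) := by
    have := DFunLike.congr_fun (hS x).eq (b 1)
    simpa using this
  have h' : b x⁻¹ = b.permuteL (Equiv.mulRight x)⁻¹ (b 1) := by simp
  rw [h, h', inner_permuteL_left, inv_inv]

/-- The canonical state is tracial on the commutant of the right translations. -/
lemma inner_mul_apply_comm (b : HilbertBasis Γ ℂ E) {S T : E →L[ℂ] E}
    (hS : ∀ x, Commute S (b.permuteL (Equiv.mulRight x)))
    (hT : ∀ x, Commute T (b.permuteL (Equiv.mulRight x))) :
    ⟪b 1, (S * T) (b 1)⟫_ℂ = ⟪b 1, (T * S) (b 1)⟫_ℂ := by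
  have key : ∀ {S T : E →L[ℂ] E}, (∀ x, Commute S (b.permuteL (Equiv.mulRight x))) →
      ⟪b 1, (S * T) (b 1)⟫_ℂ = ∑' x, ⟪b x⁻¹, S (b 1)⟫_ℂ * ⟪b x, T (b 1)⟫_ℂ := by
    intro S T hS
    rw [mul_apply_eq_comp, ← ContinuousLinearMap.adjoint_inner_left,
      ← b.tsum_inner_mul_inner]
    exact tsum_congr fun x => by
      rw [ContinuousLinearMap.adjoint_inner_left, b.inner_apply_of_commute hS]
  rw [key hS, key hT, ← (Equiv.inv Γ).tsum_eq]
  exact tsum_congr fun x => by simp [mul_comm]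

/-- If `S * T = 1` in the commutant of the right translations, then the
idempotent `T * S` fixes the canonical trace vector. -/
lemma mul_apply_one_of_mul_eq_one (b : HilbertBasis Γ ℂ E) {S T : E →L[ℂ] E}
    (hS : ∀ x, Commute S (b.permuteL (Equiv.mulRight x)))
    (hT : ∀ x, Commute T (b.permuteL (Equiv.mulRight x))) (h : S * T = 1) :
    (T * S) (b 1) = b 1 := by
  set e := T * S with he
  have hee : e * e = e := by
    rw [he, mul_assoc, ← mul_assoc S, h, one_mul]
  have hec : ∀ x, Commute e (b.permuteL (Equiv.mulRight x)) := fun x => (hT x).mul_left (hS x)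
  let K : Submodule ℂ E := (1 - e).ker
  have hK : ∀ v, v ∈ K ↔ e v = v := fun v => by
    simp only [K, LinearMap.mem_ker]
    exact sub_eq_zero.trans eq_comm
  have : CompleteSpace K := (1 - e).isClosed_ker.completeSpace_coe
  have hKR : ∀ x, ∀ v ∈ K, b.permuteL (Equiv.mulRight x) v ∈ K := fun x v hv => by
    rw [hK] at hv ⊢
    rw [← mul_apply_eq_comp, (hec x).eq, mul_apply_eq_comp, hv]
  have hqc : ∀ x, Commute K.starProjection (b.permuteL (Equiv.mulRight x)) := fun x => by
    refine ContinuousLinearMap.ext fun v => ?_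
    refine Submodule.eq_starProjection_of_mem_of_inner_eq_zero
      (hKR x _ (Submodule.starProjection_apply_mem _ _)) fun w hw => ?_
    have hx : (Equiv.mulRight x)⁻¹ = Equiv.mulRight x⁻¹ := by ext; simp
    change ⟪b.permuteL _ v - b.permuteL _ (K.starProjection v), w⟫_ℂ = 0
    rw [← map_sub, inner_permuteL_left, hx]
    exact Submodule.starProjection_inner_eq_zero _ _ (hKR _ _ hw)
  have heq : e * K.starProjection = K.starProjection := by
    ext v
    exact (hK _).1 (Submodule.starProjection_apply_mem _ _)
  have hqe : K.starProjection * e = e := by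
    refine ContinuousLinearMap.ext fun v => ?_
    refine Submodule.starProjection_eq_self_iff.2 ((hK _).2 ?_)
    exact DFunLike.congr_fun hee v
  have hb : ⟪b 1, b 1⟫_ℂ = 1 := by simp [inner_self_eq_norm_sq_to_K, b.orthonormal.1]
  have htr : ⟪b 1, K.starProjection (b 1)⟫_ℂ = 1 := by
    rw [← heq, b.inner_mul_apply_comm hec hqc, hqe, he, b.inner_mul_apply_comm hT hS, h,
      one_apply_eq_self, hb]
  have hfix : b 1 - K.starProjection (b 1) = 0 := by
    rw [← inner_self_eq_zero (𝕜 := ℂ), inner_sub_right,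
      Submodule.starProjection_inner_eq_zero _ _ (Submodule.starProjection_apply_mem _ _),
      sub_zero, inner_sub_left, hb, ← inner_conj_symm, htr, map_one, sub_self]
  rw [← hK]
  exact Submodule.starProjection_eq_self_iff.1 (sub_eq_zero.1 hfix).symm

/-- The left regular representation on a Hilbert space with a basis indexed by the group. -/
noncomputable def leftRegular (b : HilbertBasis Γ ℂ E) : Γ →* (E →L[ℂ] E) where
  toFun x := b.permuteL (Equiv.mulLeft x)
  map_one' := b.clm_ext fun i => by simp
  map_mul' x y := b.clm_ext fun i => by simp

@[simp]
lemma leftRegular_apply_self (b : HilbertBasis Γ ℂ E) (x y : Γ) :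
    b.leftRegular x (b y) = b (x * y) :=
  b.permuteL_apply_self _ _

lemma norm_leftRegular_le (b : HilbertBasis Γ ℂ E) (x : Γ) : ‖b.leftRegular x‖ ≤ 1 :=
  b.norm_permuteL_le _

lemma commute_tsum_leftRegular (b : HilbertBasis Γ ℂ E) {f : Γ → ℂ}
    (hf : Summable fun x => ‖f x‖) (x : Γ) :
    Commute (∑' y, f y • b.leftRegular y) (b.permuteL (Equiv.mulRight x)) := by
  have hs := (summable_norm_smul b.norm_leftRegular_le hf).of_norm
  unfold Commute SemiconjBy
  rw [← hs.tsum_mul_left, ← hs.tsum_mul_right]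
  refine tsum_congr fun y => ?_
  rw [smul_mul_assoc, mul_smul_comm]
  congr 1
  exact b.clm_ext fun i => by simp [mul_assoc]

end Group

end HilbertBasis

/-- The group algebra `ℓ¹(Γ)` of any group is directly finite. -/
theorem conv_eq_deltaOne_of_summable_norm {Γ : Type*} [Group Γ] {f g : Γ → ℂ}
    (hf : Summable fun x => ‖f x‖) (hg : Summable fun x => ‖g x‖)
    (h : conv g f = deltaOne Γ) : conv f g = deltaOne Γ := by
  classical
  let b : HilbertBasis Γ ℂ (lp (fun _ : Γ => ℂ) 2) := HilbertBasis.ofRepr (.refl ℂ _)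
  have hgf : (∑' x, g x • b.leftRegular x) * ∑' x, f x • b.leftRegular x = 1 := by
    refine (hasSum_conv_smul b.leftRegular b.norm_leftRegular_le hg hf).unique ?_
    have := hasSum_single (f := fun z => deltaOne Γ z • b.leftRegular z) 1 fun z hz => by
      simp [deltaOne, hz]
    simpa [h, deltaOne] using this
  have hfg := b.mul_apply_one_of_mul_eq_one (b.commute_tsum_leftRegular hg)
    (b.commute_tsum_leftRegular hf) hgf
  ext z
  have hz := (hasSum_conv_smul b.leftRegular b.norm_leftRegular_le hf hg).mapL
    ((innerSL ℂ (b z)).comp (ContinuousLinearMap.apply ℂ _ (b 1)))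
  simp only [ContinuousLinearMap.comp_apply, ContinuousLinearMap.apply_apply, hfg,
    innerSL_apply_apply, smul_apply, HilbertBasis.leftRegular_apply_self, mul_one,
    inner_smul_right, orthonormal_iff_ite.1 b.orthonormal] at hz
  have hz' := hz.unique (hasSum_single z fun y hy => by simp [hy.symm])
  simpa [deltaOne] using hz'.symm

/-- If `Γ` is amenable and `ω` is any weight on `Γ`, then `ℓ¹(Γ,ω)` is directly finite:
`g * f = δ_e` implies `f * g = δ_e`. -/
theorem stmt13 {Γ : Type*} [Group Γ] (hΓ : IsAmenable Γ) (ω : Γ → ℝ)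
    (hωpos : ∀ x, 0 < ω x) (hωsub : ∀ x y, ω (x * y) ≤ ω x * ω y)
    (f g : Γ → ℂ)
    (hf : Summable fun x => ‖f x‖ * ω x) (hg : Summable fun x => ‖g x‖ * ω x)
    (h : conv g f = deltaOne Γ) : conv f g = deltaOne Γ := by
  obtain ⟨φ, hφmul, hφle⟩ := hΓ.exists_additive_le_log hωpos hωsub
  have hφ1 : φ 1 = 0 := by simpa using hφmul 1 1
  have hsum : ∀ k : Γ → ℂ, (Summable fun x => ‖k x‖ * ω x) →
      Summable fun x => ‖(Real.exp (φ x) : ℂ) * k x‖ := fun k hk => by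
    refine (hk.mul_left (Real.exp 1)).of_nonneg_of_le (fun _ => norm_nonneg _) fun x => ?_
    rw [norm_mul, Complex.norm_real, Real.norm_of_nonneg (Real.exp_pos _).le, mul_comm,
      mul_left_comm]
    gcongr
    calc Real.exp (φ x) ≤ Real.exp (Real.log (ω x) + 1) := Real.exp_le_exp.2 (hφle x)
      _ = Real.exp 1 * ω x := by rw [Real.exp_add, Real.exp_log (hωpos x), mul_comm]
  have hconv : ∀ (k l : Γ → ℂ) (z : Γ),
      conv (fun x => (Real.exp (φ x) : ℂ) * k x) (fun x => (Real.exp (φ x) : ℂ) * l x) z =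
        (Real.exp (φ z) : ℂ) * conv k l z := fun k l z => by
    unfold conv
    rw [← tsum_mul_left]
    refine tsum_congr fun y => ?_
    have : (Real.exp (φ z) : ℂ) = (Real.exp (φ (z * y⁻¹)) : ℂ) * (Real.exp (φ y) : ℂ) := by
      rw [← Complex.ofReal_mul, ← Real.exp_add, ← hφmul, inv_mul_cancel_right]
    rw [this]
    ring
  have hδ : ∀ z, (Real.exp (φ z) : ℂ) * deltaOne Γ z = deltaOne Γ z := fun z => by
    by_cases hz : z = 1
    · simp [hz, hφ1]
    · simp [deltaOne, hz]
  have key := conv_eq_deltaOne_of_summable_norm (hsum f hf) (hsum g hg)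
    (by ext z; rw [hconv, h, hδ])
  ext z
  have hz := congrFun key z
  rw [hconv, ← hδ z] at hz
  exact mul_left_cancel₀ (Complex.ofReal_ne_zero.2 (Real.exp_pos _).ne') hz
end
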